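/- For every ε > 0 there exists a constant C > 0 such that for all N ∈ ℕ, |f(N) − π(N) − π(N^{1/2})| ≤ C·N^{5/12+ε}. (In asymptotic notation: f(N) = π(N) + π(N^{1/2}) + O(N^{5/12+o(1)}).) -/

import Mathlib

/-- A set of positive integers has *distinct subset products* if any two distinct
finite subsets have distinct products (the empty product is `1`). -/
def DistinctSubsetProds (A : Set ℕ) : Prop :=
  ∀ B C : Finset ℕ, ↑B ⊆ A → ↑C ⊆ A → ∏ b ∈ B, b = ∏ c ∈ C, c → B = C

/-- `primePi x` is the number of primes `p` with `(p : ℝ) ≤ x`. -/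
noncomputable def primePi (x : ℝ) : ℕ := {p : ℕ | p.Prime ∧ (p : ℝ) ≤ x}.ncard

/-- `maxDSP N` is the size of the largest subset of `{1, …, N}` with distinct
subset products. -/
noncomputable def maxDSP (N : ℕ) : ℕ :=
  sSup {k | ∃ A : Finset ℕ, ↑A ⊆ Set.Icc 1 N ∧ DistinctSubsetProds ↑A ∧ A.card = k}

lemma two_pow_mul_pow_le {d : ℕ} (hd : 0 < d) (m : ℕ) :
    2 ^ m * d ^ (d * m) ≤ (d + 1) ^ (d * m) := by
  have h : 2 * d ^ d ≤ (d + 1) ^ d := by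
    have h1 := pow_add_mul_le_add_pow (a := d) (b := 1) (by omega) (by omega) d
    have h2 : d * d ^ (d - 1) = d ^ d := mul_pow_sub_one hd.ne' d
    simp only [Nat.cast_id, mul_one, h2] at h1
    omega
  rw [pow_mul, pow_mul, ← mul_pow]
  exact Nat.pow_le_pow_left h m

section Graph

variable {ι V : Type*} [DecidableEq V]

/-- The incidence vector of the edge `a` joining `x a` to `y a`; a loop counts twice. -/
def incidence (x y : ι → V) (a : ι) : V → ℤ :=
  Pi.single (x a) 1 + Pi.single (y a) 1

/-- `S` is a nonempty set of at most `L` edges whose incidence vectors satisfy a linear relation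
with all coefficients equal to `1` or `-1`. -/
def IsSignedRelation (x y : ι → V) (L : ℕ) (S : Finset ι) : Prop :=
  S.Nonempty ∧ S.card ≤ L ∧ ∃ ε : ι → ℤ, (∀ a, ε a = 1 ∨ ε a = -1) ∧
    ∑ a ∈ S, ε a • incidence x y a = 0

lemma IsSignedRelation.mono {x y : ι → V} {L L' : ℕ} {S : Finset ι}
    (h : IsSignedRelation x y L S) (hL : L ≤ L') : IsSignedRelation x y L' S :=
  ⟨h.1, h.2.1.trans hL, h.2.2⟩

lemma exists_isSignedRelation_of_sum_eq_zero {x y : ι → V} {L : ℕ} {A Q : Finset ι} (hQ : Q ⊆ A)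
    (hL : Q.card ≤ L) (η : ι → ℤ) (hη : ∀ a ∈ Q, η a = 0 ∨ η a = 1 ∨ η a = -1)
    {a₀ : ι} (ha₀ : a₀ ∈ Q) (hne : η a₀ ≠ 0) (hsum : ∑ a ∈ Q, η a • incidence x y a = 0) :
    ∃ S ⊆ A, IsSignedRelation x y L S := by
  refine ⟨Q.filter (η · ≠ 0), (Finset.filter_subset _ _).trans hQ, ⟨a₀, by simp [ha₀, hne]⟩,
    (Finset.card_filter_le _ _).trans hL, fun a => if η a = 1 then 1 else -1, fun a => ?_, ?_⟩
  · by_cases h : η a = 1 <;> simp [h]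
  · rw [← hsum, Finset.sum_filter]
    refine Finset.sum_congr rfl fun a ha => ?_
    rcases hη a ha with h | h | h <;> simp [h]

/-- A family of paths of length at most `r` from a root `o` to all vertices of `B`, with signs
alternating along each of them, whose `edges` form a tree. -/
structure SignedTree (x y : ι → V) (A : Finset ι) (o : V) (B : Finset V) (r : ℕ) where
  sign : V → ℤ
  edgeSign : ι → ℤ
  path : V → Finset ι
  edges : Finset ι
  sign_eq : ∀ v, sign v = 1 ∨ sign v = -1
  edgeSign_eq : ∀ a, edgeSign a = 1 ∨ edgeSign a = -1
  path_subset : ∀ v ∈ B, path v ⊆ edges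
  card_path : ∀ v ∈ B, (path v).card ≤ r
  sum_path : ∀ v ∈ B, ∑ a ∈ path v, edgeSign a • incidence x y a =
    Pi.single v (sign v) - Pi.single o 1
  edges_subset : edges ⊆ A
  ends_mem : ∀ a ∈ edges, x a ∈ B ∧ y a ∈ B
  card_edges : edges.card + 1 ≤ B.card

lemma signedTree_singleton (x y : ι → V) (A : Finset ι) (o : V) :
    Nonempty (SignedTree x y A o {o} 0) :=
  ⟨{ sign := fun _ => 1
     edgeSign := fun _ => 1
     path := fun _ => ∅
     edges := ∅
     sign_eq := by simp
     edgeSign_eq := by simp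
     path_subset := by simp
     card_path := by simp
     sum_path := by simp
     edges_subset := by simp
     ends_mem := by simp
     card_edges := by simp }⟩

variable [DecidableEq ι]

lemma SignedTree.extend [Nonempty ι] {x y : ι → V} {A : Finset ι} {o : V} {B B' : Finset V} {r : ℕ}
    (D : SignedTree x y A o B r) (hBB : B ⊆ B')
    (h : ∀ c ∈ B', c ∉ B → ∃ a ∈ A, (x a ∈ B ∧ y a = c) ∨ (y a ∈ B ∧ x a = c)) :
    Nonempty (SignedTree x y A o B' (r + 1)) := by
  have h' : ∀ c, c ∈ B' ∧ c ∉ B → ∃ a p, a ∈ A ∧ p ∈ B ∧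
      ((x a = p ∧ y a = c) ∨ (y a = p ∧ x a = c)) := by
    rintro c ⟨h1, h2⟩
    obtain ⟨a, ha, h | h⟩ := h c h1 h2
    · exact ⟨a, x a, ha, h.1, Or.inl ⟨rfl, h.2⟩⟩
    · exact ⟨a, y a, ha, h.1, Or.inr ⟨rfl, h.2⟩⟩
  have : Nonempty V := ⟨o⟩
  choose! e p heA hpB hends using h'
  have heF : ∀ c, c ∈ B' ∧ c ∉ B → e c ∉ D.edges := by
    intro c hc h1
    have h2 := D.ends_mem _ h1
    rcases hends c hc with h3 | h3
    · exact hc.2 (h3.2 ▸ h2.2)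
    · exact hc.2 (h3.2 ▸ h2.1)
  set s : V → ℤ := fun v => if v ∈ B then D.sign v else - D.sign (p v) with hs
  set τ : ι → ℤ := fun a => if a ∈ D.edges then D.edgeSign a else
    s (if x a ∈ B then y a else x a) with hτ
  have hs' : ∀ v, s v = 1 ∨ s v = -1 := by
    intro v
    by_cases hv : v ∈ B
    · simpa [hs, hv] using D.sign_eq v
    · rcases D.sign_eq (p v) with h | h <;> simp [hs, hv, h]
  have hτe : ∀ c, c ∈ B' ∧ c ∉ B → τ (e c) = - D.sign (p c) := by
    intro c hc
    rcases hends c hc with h3 | h3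
    · have : x (e c) ∈ B := h3.1 ▸ hpB c hc
      simp [hτ, heF c hc, this, h3.2, hs, hc.2]
    · simp [hτ, heF c hc, h3.2, hs, hc.2]
  have hsum : ∀ v ∈ B, ∑ a ∈ D.path v, τ a • incidence x y a =
      Pi.single v (D.sign v) - Pi.single o 1 := by
    intro v hv
    rw [← D.sum_path v hv]
    refine Finset.sum_congr rfl fun a ha => ?_
    simp [hτ, D.path_subset v hv ha]
  have hinc : ∀ c, c ∈ B' ∧ c ∉ B →
      incidence x y (e c) = Pi.single c 1 + Pi.single (p c) 1 := by
    intro c hc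
    rcases hends c hc with h3 | h3 <;> simp [incidence, h3.1, h3.2, add_comm]
  refine ⟨{ sign := s
            edgeSign := τ
            path := fun v => if v ∈ B then D.path v else insert (e v) (D.path (p v))
            edges := D.edges ∪ (B' \ B).image e
            sign_eq := hs'
            edgeSign_eq := ?_
            path_subset := ?_
            card_path := ?_
            sum_path := ?_
            edges_subset := ?_
            ends_mem := ?_
            card_edges := ?_ }⟩
  · intro a
    by_cases ha : a ∈ D.edges
    · simpa [hτ, ha] using D.edgeSign_eq a
    · simpa only [hτ, ha, if_false] using hs' _
  · intro v hv
    by_cases hvB : v ∈ B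
    · simpa [hvB] using (D.path_subset v hvB).trans Finset.subset_union_left
    · simp only [hvB, if_false]
      refine Finset.insert_subset ?_
        ((D.path_subset _ (hpB v ⟨hv, hvB⟩)).trans Finset.subset_union_left)
      exact Finset.mem_union_right _ (Finset.mem_image_of_mem _ (by simp [hv, hvB]))
  · intro v hv
    by_cases hvB : v ∈ B
    · simpa [hvB] using (D.card_path v hvB).trans (Nat.le_succ r)
    · simp only [hvB, if_false]
      exact (Finset.card_insert_le _ _).trans
        (Nat.succ_le_succ (D.card_path _ (hpB v ⟨hv, hvB⟩)))
  · intro v hv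
    by_cases hvB : v ∈ B
    · simpa [hvB, hs] using hsum v hvB
    · have hc : v ∈ B' ∧ v ∉ B := ⟨hv, hvB⟩
      have hnot : e v ∉ D.path (p v) := fun h => heF v hc (D.path_subset _ (hpB v hc) h)
      simp only [hvB, if_false]
      rw [Finset.sum_insert hnot, hsum _ (hpB v hc), hτe v hc, hinc v hc]
      ext w
      simp only [hs, hvB, if_false, Pi.add_apply, Pi.smul_apply, Pi.sub_apply, Pi.single_apply,
        smul_eq_mul]
      split_ifs <;> ring
  · refine Finset.union_subset D.edges_subset ?_
    intro a ha
    obtain ⟨c, hc, rfl⟩ := Finset.mem_image.1 ha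
    exact heA c (by simpa using hc)
  · intro a ha
    rcases Finset.mem_union.1 ha with ha | ha
    · exact ⟨hBB (D.ends_mem a ha).1, hBB (D.ends_mem a ha).2⟩
    · obtain ⟨c, hc, rfl⟩ := Finset.mem_image.1 ha
      rw [Finset.mem_sdiff] at hc
      have hp := hBB (hpB c hc)
      rcases hends c hc with h3 | h3
      · rw [h3.1, h3.2]
        exact ⟨hp, hc.1⟩
      · rw [h3.1, h3.2]
        exact ⟨hc.1, hp⟩
  · have h1 := Finset.card_union_le D.edges ((B' \ B).image e)
    have h2 : ((B' \ B).image e).card ≤ (B' \ B).card := Finset.card_image_le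
    have h3 := Finset.card_sdiff_add_card_eq_card hBB
    have h4 := D.card_edges
    omega

/-- Two non-tree edges with the same first endpoint yield a signed relation. -/
lemma SignedTree.exists_isSignedRelation {x y : ι → V} {A : Finset ι} {o : V} {B : Finset V}
    {r : ℕ} (D : SignedTree x y A o B r) {f g : ι} (hf : f ∈ A) (hg : g ∈ A)
    (hfF : f ∉ D.edges) (hgF : g ∉ D.edges) (hfg : f ≠ g) (hxf : x f ∈ B) (hyf : y f ∈ B)
    (hyg : y g ∈ B) (hx : x f = x g) :
    ∃ S ⊆ A, IsSignedRelation x y (2 * r + 2) S := by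
  have hcard : ∀ u ∈ B, ∀ v ∈ B, (D.path u ∪ D.path v).card ≤ 2 * r := fun u hu v hv => by
    have := Finset.card_union_le (D.path u) (D.path v)
    have := D.card_path u hu
    have := D.card_path v hv
    omega
  have hsubF : ∀ u ∈ B, ∀ v ∈ B, D.path u ∪ D.path v ⊆ D.edges := fun u hu v hv =>
    Finset.union_subset (D.path_subset u hu) (D.path_subset v hv)
  let c (u v : V) (a : ι) : ℤ :=
    D.edgeSign a * ((if a ∈ D.path u then 1 else 0) - (if a ∈ D.path v then 1 else 0))
  have hc : ∀ u v a, c u v a = 0 ∨ c u v a = 1 ∨ c u v a = -1 := by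
    intro u v a
    rcases D.edgeSign_eq a with h | h <;> simp only [c, h] <;> split_ifs <;> simp
  have hcsum : ∀ u ∈ B, ∀ v ∈ B, ∑ a ∈ D.path u ∪ D.path v, c u v a • incidence x y a =
      Pi.single u (D.sign u) - Pi.single v (D.sign v) := by
    intro u hu v hv
    have h1 : ∑ a ∈ D.path u ∪ D.path v, c u v a • incidence x y a =
        ∑ a ∈ D.path u, D.edgeSign a • incidence x y a -
          ∑ a ∈ D.path v, D.edgeSign a • incidence x y a := by
      simp only [c, mul_sub, sub_smul, Finset.sum_sub_distrib, mul_ite, mul_one, mul_zero,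
        ite_smul, zero_smul, ← Finset.sum_filter, Finset.filter_mem_eq_inter,
        Finset.union_inter_cancel_left, Finset.union_inter_cancel_right]
    rw [h1, D.sum_path u hu, D.sum_path v hv]
    abel
  have key : ∀ f ∈ A, f ∉ D.edges → x f ∈ B → y f ∈ B → D.sign (x f) = - D.sign (y f) →
      ∃ S ⊆ A, IsSignedRelation x y (2 * r + 2) S := by
    intro f hf hfF hxf hyf hsgn
    have hfQ : f ∉ D.path (x f) ∪ D.path (y f) := fun h => hfF (hsubF _ hxf _ hyf h)
    refine exists_isSignedRelation_of_sum_eq_zero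
      (Q := insert f (D.path (x f) ∪ D.path (y f)))
      (Finset.insert_subset hf ((hsubF _ hxf _ hyf).trans D.edges_subset)) ?_
      (fun a => if a = f then - D.sign (x f) else c (x f) (y f) a) ?_
      (Finset.mem_insert_self _ _) ?_ ?_
    · exact (Finset.card_insert_le _ _).trans (by have := hcard _ hxf _ hyf; omega)
    · intro a _
      by_cases haf : a = f
      · rcases D.sign_eq (x f) with h | h <;> simp [haf, h]
      · simpa [haf] using hc _ _ a
    · rcases D.sign_eq (x f) with h | h <;> simp [h]
    · rw [Finset.sum_insert hfQ, Finset.sum_congr rfl (g := fun a =>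
        c (x f) (y f) a • incidence x y a), hcsum _ hxf _ hyf]
      · ext w
        simp only [incidence, if_true, Pi.add_apply, Pi.smul_apply, Pi.sub_apply, Pi.single_apply,
          smul_eq_mul, Pi.zero_apply, hsgn]
        split_ifs <;> ring
      · intro a ha
        rw [if_neg (ne_of_mem_of_not_mem ha hfQ)]
  by_cases h1 : D.sign (x f) = - D.sign (y f)
  · exact key f hf hfF hxf hyf h1
  by_cases h2 : D.sign (x g) = - D.sign (y g)
  · exact key g hg hgF (hx ▸ hxf) hyg h2
  have h3 : D.sign (y f) = D.sign (x f) := by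
    rcases D.sign_eq (x f) with h | h <;> rcases D.sign_eq (y f) with h' | h' <;> simp_all
  have h4 : D.sign (y g) = D.sign (x f) := by
    rw [hx]
    rcases D.sign_eq (x g) with h | h <;> rcases D.sign_eq (y g) with h' | h' <;> simp_all
  have hsub := hsubF _ hyf _ hyg
  have hgQ : g ∉ D.path (y f) ∪ D.path (y g) := fun h => hgF (hsub h)
  have hfQ' : f ∉ D.path (y f) ∪ D.path (y g) := fun h => hfF (hsub h)
  have hfQ : f ∉ insert g (D.path (y f) ∪ D.path (y g)) := by
    rw [Finset.mem_insert, not_or]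
    exact ⟨hfg, hfQ'⟩
  refine exists_isSignedRelation_of_sum_eq_zero
    (Q := insert f (insert g (D.path (y f) ∪ D.path (y g))))
    (Finset.insert_subset hf (Finset.insert_subset hg (hsub.trans D.edges_subset))) ?_
    (fun a => if a = f then - D.sign (x f) else if a = g then D.sign (x f) else
      c (y f) (y g) a) ?_ (Finset.mem_insert_self _ _) ?_ ?_
  · refine (Finset.card_insert_le _ _).trans (Nat.succ_le_succ
      ((Finset.card_insert_le _ _).trans (Nat.succ_le_succ (hcard _ hyf _ hyg))))
  · intro a _
    by_cases haf : a = f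
    · rcases D.sign_eq (x f) with h | h <;> simp [haf, h]
    · by_cases hag : a = g
      · rcases D.sign_eq (x f) with h | h <;> simp [hag, hfg.symm, h]
      · simpa [haf, hag] using hc _ _ a
  · rcases D.sign_eq (x f) with h | h <;> simp [h]
  · rw [Finset.sum_insert hfQ, Finset.sum_insert hgQ, Finset.sum_congr rfl (g := fun a =>
      c (y f) (y g) a • incidence x y a), hcsum _ hyf _ hyg]
    · ext w
      simp only [incidence, if_true, if_neg hfg.symm, Pi.add_apply, Pi.smul_apply, Pi.sub_apply,
        Pi.single_apply, smul_eq_mul, Pi.zero_apply, h3, h4, hx]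
      split_ifs <;> ring
    · intro a ha
      rw [if_neg (ne_of_mem_of_not_mem ha hfQ'), if_neg (ne_of_mem_of_not_mem ha hgQ)]

/-- If a tree spans too many edges, there is a short signed relation. -/
lemma SignedTree.exists_isSignedRelation_of_card_le {x y : ι → V} {A : Finset ι} {o : V}
    {B T : Finset V} {r : ℕ} (D : SignedTree x y A o B r) (hT : ∀ a ∈ A, x a ∈ T)
    (h : B.card + (B ∩ T).card ≤ (A.filter fun a => x a ∈ B ∧ y a ∈ B).card) :
    ∃ S ⊆ A, IsSignedRelation x y (2 * r + 2) S := by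
  have h1 := D.card_edges
  have h2 := Finset.le_card_sdiff D.edges (A.filter fun a => x a ∈ B ∧ y a ∈ B)
  obtain ⟨f, hf, g, hg, hfg, hx⟩ := Finset.exists_ne_map_eq_of_card_lt_of_maps_to
    (s := (A.filter fun a => x a ∈ B ∧ y a ∈ B) \ D.edges) (t := B ∩ T) (f := x) (by omega)
    (fun a ha => by
      simp only [Finset.coe_sdiff, Set.mem_sdiff, Finset.mem_coe, Finset.mem_filter] at ha
      exact Finset.mem_coe.2 (Finset.mem_inter.2 ⟨ha.1.2.1, hT a ha.1.1⟩))
  simp only [Finset.mem_sdiff, Finset.mem_filter] at hf hg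
  exact D.exists_isSignedRelation hf.1.1 hg.1.1 hf.2 hg.2 hfg hf.1.2.1 hf.1.2.2 hg.1.2.2 hx

/-- The vertices in `B` together with their neighbours along the edges in `A`. -/
def closedNeighborhood (x y : ι → V) (A : Finset ι) (B : Finset V) : Finset V :=
  B ∪ ((A.filter fun a => x a ∈ B).image y ∪ (A.filter fun a => y a ∈ B).image x)

lemma signedTree_iterate [Nonempty ι] (x y : ι → V) (A : Finset ι) (o : V) (r : ℕ) :
    Nonempty (SignedTree x y A o ((closedNeighborhood x y A)^[r] {o}) r) := by
  induction r with
  | zero => exact signedTree_singleton x y A o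
  | succ r ih =>
    obtain ⟨D⟩ := ih
    rw [Function.iterate_succ_apply']
    refine D.extend Finset.subset_union_left fun c hc hcB => ?_
    simp only [closedNeighborhood, Finset.mem_union, Finset.mem_image, Finset.mem_filter] at hc
    rcases hc with hc | ⟨a, ha, h⟩ | ⟨a, ha, h⟩
    · exact absurd hc hcB
    · exact ⟨a, ha.1, Or.inl ⟨ha.2, h⟩⟩
    · exact ⟨a, ha.1, Or.inr ⟨ha.2, h⟩⟩

/-- A graph in which the number of edges exceeds `1 + 1 / d` times the number of vertices, those
in `T` counted twice, has a short signed relation. -/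
lemma exists_isSignedRelation_of_dense [Nonempty ι] {x y : ι → V} {T : Finset V} {d m : ℕ}
    (hd : 0 < d) (U : Finset V) : ∀ A : Finset ι, (∀ a ∈ A, x a ∈ T) →
    (∀ a ∈ A, x a ∈ U ∧ y a ∈ U) → U.Nonempty →
    (d + 1) * (U.card + (U ∩ T).card) ≤ d * A.card → U.card + (U ∩ T).card < 2 ^ m →
    ∃ S ⊆ A, IsSignedRelation x y (2 * (d * m) + 2) S := by
  induction U using Finset.strongInduction with
  | H U ih =>
  intro A hT hU hne hdense hm
  by_cases hS : ∃ S ⊂ U, S.Nonempty ∧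
      d * (A.filter fun a => x a ∈ S ∨ y a ∈ S).card ≤ (d + 1) * (S.card + (S ∩ T).card)
  · obtain ⟨S, hSU, hSne, hcard⟩ := hS
    have h1 := Finset.card_sdiff_add_card_eq_card hSU.1
    have h2 : ((U \ S) ∩ T).card + (S ∩ T).card = (U ∩ T).card := by
      rw [← Finset.card_union_of_disjoint, ← Finset.union_inter_distrib_right,
        Finset.sdiff_union_of_subset hSU.1]
      exact Finset.disjoint_of_subset_left Finset.inter_subset_left
        (Finset.disjoint_of_subset_right Finset.inter_subset_left Finset.sdiff_disjoint)
    have h3 := Finset.card_filter_add_card_filter_not (s := A) (fun a => x a ∈ S ∨ y a ∈ S)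
    obtain ⟨R, hR, hrel⟩ := ih (U \ S) (Finset.sdiff_ssubset hSU.1 hSne)
      (A.filter fun a => ¬ (x a ∈ S ∨ y a ∈ S))
      (fun a ha => hT a (Finset.mem_filter.1 ha).1)
      (fun a ha => by
        rw [Finset.mem_filter, not_or] at ha
        simp [hU a ha.1, ha.2])
      (Finset.sdiff_nonempty.2 hSU.2) (by
        rw [← h3, mul_add] at hdense
        rw [← h1, ← h2] at hdense
        linarith) (by omega)
    exact ⟨R, hR.trans (Finset.filter_subset _ _), hrel⟩
  push Not at hS
  have hS' : ∀ S ⊆ U, S.Nonempty →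
      (d + 1) * (S.card + (S ∩ T).card) ≤ d * (A.filter fun a => x a ∈ S ∨ y a ∈ S).card := by
    intro S hSU hSne
    rcases hSU.eq_or_ssubset with rfl | h
    · rwa [Finset.filter_true_of_mem fun a ha => Or.inl (hU a ha).1]
    · exact (hS S h hSne).le
  by_contra hrel
  obtain ⟨o, ho⟩ := hne
  set B : ℕ → Finset V := fun r => (closedNeighborhood x y A)^[r] {o} with hB
  have hBsucc : ∀ r, B (r + 1) = closedNeighborhood x y A (B r) := fun r =>
    Function.iterate_succ_apply' _ _ _
  have hBU : ∀ r, B r ⊆ U := by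
    intro r
    induction r with
    | zero => simpa [hB] using ho
    | succ r ihr =>
      rw [hBsucc]
      refine Finset.union_subset ihr (Finset.union_subset ?_ ?_) <;>
      · rw [Finset.image_subset_iff]
        intro a ha
        simp [hU a (Finset.mem_filter.1 ha).1]
  have hBne : ∀ r, (B r).Nonempty := by
    intro r
    induction r with
    | zero => simp [hB]
    | succ r ihr =>
      rw [hBsucc]
      exact ihr.mono Finset.subset_union_left
  have hgrow : ∀ r, r + 1 ≤ d * m → (d + 1) * ((B r).card + (B r ∩ T).card) ≤
      d * ((B (r + 1)).card + (B (r + 1) ∩ T).card) := by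
    intro r hr
    refine (hS' _ (hBU r) (hBne r)).trans (Nat.mul_le_mul_left d ?_)
    obtain ⟨D⟩ := signedTree_iterate x y A o (r + 1)
    by_contra hlt
    refine hrel ?_
    obtain ⟨S, hSA, hS⟩ := D.exists_isSignedRelation_of_card_le hT (by
      refine (not_le.1 hlt).le.trans (Finset.card_le_card fun a ha => ?_)
      rw [Finset.mem_filter] at ha ⊢
      have hx : ∀ b ∈ A, x b ∈ B r → y b ∈ B (r + 1) := fun b hb h => by
        rw [hBsucc]
        exact Finset.mem_union_right _ (Finset.mem_union_left _
          (Finset.mem_image_of_mem _ (by simp [hb, h])))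
      have hy : ∀ b ∈ A, y b ∈ B r → x b ∈ B (r + 1) := fun b hb h => by
        rw [hBsucc]
        exact Finset.mem_union_right _ (Finset.mem_union_right _
          (Finset.mem_image_of_mem _ (by simp [hb, h])))
      have hBB : B r ⊆ B (r + 1) := by
        rw [hBsucc]
        exact Finset.subset_union_left
      rcases ha.2 with h | h
      · exact ⟨ha.1, hBB h, hx a ha.1 h⟩
      · exact ⟨ha.1, hy a ha.1 h, hBB h⟩)
    exact ⟨S, hSA, hS.mono (by omega)⟩
  have hpow : ∀ r ≤ d * m, (d + 1) ^ r ≤ d ^ r * ((B r).card + (B r ∩ T).card) := by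
    intro r
    induction r with
    | zero =>
      intro _
      have := (hBne 0).card_pos
      simp only [pow_zero, one_mul]
      omega
    | succ r ihr =>
      intro hr
      calc (d + 1) ^ (r + 1) = (d + 1) ^ r * (d + 1) := pow_succ _ _
        _ ≤ d ^ r * ((B r).card + (B r ∩ T).card) * (d + 1) :=
          Nat.mul_le_mul_right _ (ihr (by omega))
        _ = d ^ r * ((d + 1) * ((B r).card + (B r ∩ T).card)) := by ring
        _ ≤ d ^ r * (d * ((B (r + 1)).card + (B (r + 1) ∩ T).card)) :=
          Nat.mul_le_mul_left _ (hgrow r hr)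
        _ = _ := by ring
  have h1 := (two_pow_mul_pow_le hd m).trans (hpow (d * m) le_rfl)
  rw [mul_comm] at h1
  have h2 := Nat.le_of_mul_le_mul_left h1 (pow_pos hd _)
  have h3 := Finset.card_le_card (hBU (d * m))
  have h4 := Finset.card_le_card (Finset.inter_subset_inter_right (u := T) (hBU (d * m)))
  omega

/-- The bound on the number of edges of a graph without short signed relations. -/
lemma card_le_of_forall_not_isSignedRelation [Nonempty ι] {x y : ι → V} {T H : Finset V}
    {A : Finset ι} {d m : ℕ} (hd : 3 ≤ d) (hT : T.Nonempty) (hTH : Disjoint T H)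
    (hx : ∀ a ∈ A, x a ∈ T) (hy : ∀ a ∈ A, y a ∈ T ∪ H) (hm : 6 * T.card < 2 ^ m)
    (hrel : ∀ S ⊆ A, ¬ IsSignedRelation x y (2 * (d * m) + 2) S) :
    d * A.card ≤ d * (H.card + 2 * T.card) + 6 * T.card := by
  have hinter : ∀ G ⊆ H, ((T ∪ G) ∩ T).card = T.card := fun G hG => by
    rw [Finset.inter_eq_right.2 Finset.subset_union_left]
  have hunion : ∀ G ⊆ H, (T ∪ G).card = T.card + G.card := fun G hG =>
    Finset.card_union_of_disjoint (Finset.disjoint_of_subset_right hG hTH)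
  set H' := H.filter fun h => 2 ≤ (A.filter fun a => y a = h).card with hH'
  have hH'H : H' ⊆ H := Finset.filter_subset _ _
  rcases le_or_gt H'.card (4 * T.card) with hle | hgt
  · have h1 : (A.filter fun a => ¬ y a ∈ T ∪ H').card ≤ (H \ H').card := by
      refine Finset.card_le_card_of_injOn y (fun a ha => ?_) fun a ha b hb hab => ?_
      · simp only [Finset.coe_filter, Set.mem_ofPred_eq, Finset.mem_union, not_or] at ha
        have := hy a ha.1
        simp only [Finset.mem_union] at this
        simp only [Finset.coe_sdiff, Set.mem_sdiff, Finset.mem_coe]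
        tauto
      · simp only [Finset.coe_filter, Set.mem_ofPred_eq, Finset.mem_union, not_or] at ha hb
        have hyH : y a ∈ H := by
          have := hy a ha.1
          simp only [Finset.mem_union] at this
          tauto
        by_contra hne
        refine ha.2.2 (Finset.mem_filter.2 ⟨hyH, ?_⟩)
        exact Finset.one_lt_card.2 ⟨a, by simp [ha.1], b, by simp [hb.1, hab], hne⟩
    have h2 := Finset.card_filter_add_card_filter_not (s := A) (fun a => y a ∈ T ∪ H')
    have h3 := Finset.card_sdiff_add_card_eq_card hH'H
    have h4 : d * (A.filter fun a => y a ∈ T ∪ H').card <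
        (d + 1) * ((T ∪ H').card + ((T ∪ H') ∩ T).card) := by
      by_contra hlt
      obtain ⟨S, hS, hSrel⟩ := exists_isSignedRelation_of_dense (d := d) (m := m) (by omega) (T ∪ H')
        (A.filter fun a => y a ∈ T ∪ H') (fun a ha => hx a (Finset.mem_filter.1 ha).1)
        (fun a ha => by
          rw [Finset.mem_filter] at ha
          exact ⟨Finset.mem_union_left _ (hx a ha.1), ha.2⟩)
        (hT.mono Finset.subset_union_left) (not_lt.1 hlt)
        (by rw [hinter _ hH'H, hunion _ hH'H]; omega)
      exact hrel S (hS.trans (Finset.filter_subset _ _)) hSrel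
    rw [hinter _ hH'H, hunion _ hH'H] at h4
    have h5 := Nat.mul_le_mul_left d h1
    rw [← h2, ← h3]
    nlinarith
  · exfalso
    obtain ⟨G, hG, hGcard⟩ := Finset.exists_subset_card_eq hgt.le
    have hGH := hG.trans hH'H
    have h1 : G.card * 2 ≤ (A.filter fun a => y a ∈ G).card := by
      rw [Finset.card_eq_sum_card_fiberwise (f := y) (t := G) (fun a ha => by simpa using
        (Finset.mem_filter.1 ha).2)]
      rw [← smul_eq_mul]
      refine Finset.card_nsmul_le_sum _ _ _ fun h hh => ?_
      rw [Finset.filter_filter]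
      refine (Finset.mem_filter.1 (hG hh)).2.trans (Finset.card_le_card fun a ha => ?_)
      rw [Finset.mem_filter] at ha ⊢
      exact ⟨ha.1, ha.2 ▸ hh, ha.2⟩
    obtain ⟨S, hS, hSrel⟩ := exists_isSignedRelation_of_dense (d := d) (m := m) (by omega) (T ∪ G)
      (A.filter fun a => y a ∈ G) (fun a ha => hx a (Finset.mem_filter.1 ha).1)
      (fun a ha => by
        rw [Finset.mem_filter] at ha
        exact ⟨Finset.mem_union_left _ (hx a ha.1), Finset.mem_union_right _ ha.2⟩)
      (hT.mono Finset.subset_union_left)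
      (by
        rw [hinter _ hGH, hunion _ hGH, hGcard]
        rw [hGcard] at h1
        have := Nat.mul_le_mul_left d h1
        nlinarith)
      (by rw [hinter _ hGH, hunion _ hGH]; omega)
    exact hrel S (hS.trans (Finset.filter_subset _ _)) hSrel

end Graph

section Multiplicative

lemma factorization_prime_mul {p b : ℕ} (hp : p.Prime) (hb : b ≠ 0) (r : ℕ) :
    (p * b).factorization r = (if p = r then 1 else 0) + b.factorization r := by
  rw [Nat.factorization_mul hp.ne_zero hb, hp.factorization, Finsupp.add_apply,
    Finsupp.single_apply]

/-- A positive integer below `(M + 1) ^ 3` has at most two prime factors above `M`. -/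
lemma exists_large_prime_factors {N M a : ℕ} (hM : N < (M + 1) ^ 3) (ha : a ≠ 0) (haN : a ≤ N) :
    ∃ x y : ℕ, (x = 1 ∨ x.Prime) ∧ (y = 1 ∨ y.Prime) ∧ x * x ≤ N ∧ y ≤ N ∧
      ∀ p, p.Prime → M < p →
        a.factorization p = (if x = p then 1 else 0) + (if y = p then 1 else 0) := by
  have hone : ∀ p : ℕ, p.Prime → (1 : ℕ) ≠ p := fun p hp => hp.one_lt.ne
  have h1N : 1 ≤ N := by omega
  by_cases hp : ∃ p, p.Prime ∧ M < p ∧ p ∣ a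
  · obtain ⟨p, hp, hMp, b, rfl⟩ := hp
    have hb : b ≠ 0 := right_ne_zero_of_mul ha
    by_cases hq : ∃ q, q.Prime ∧ M < q ∧ q ∣ b
    · obtain ⟨q, hq, hMq, c, rfl⟩ := hq
      have hc : c ≠ 0 := right_ne_zero_of_mul hb
      have hpq : p * q ≤ N := by
        refine le_trans ?_ haN
        rw [← mul_assoc]
        exact Nat.le_mul_of_pos_right _ (Nat.pos_of_ne_zero hc)
      have hfac : ∀ r, r.Prime → M < r → (p * (q * c)).factorization r =
          (if p = r then 1 else 0) + (if q = r then 1 else 0) := by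
        intro r hr hMr
        rw [factorization_prime_mul hp hb, factorization_prime_mul hq hc,
          Nat.factorization_eq_zero_of_not_dvd (n := c), add_zero]
        intro hrc
        have h1 : (M + 1) ^ 3 ≤ p * (q * c) := by
          calc (M + 1) ^ 3 = (M + 1) * ((M + 1) * (M + 1)) := by ring
            _ ≤ p * (q * c) := Nat.mul_le_mul hMp (Nat.mul_le_mul hMq
              (hMr.trans_le (Nat.le_of_dvd (Nat.pos_of_ne_zero hc) hrc)))
        omega
      rcases le_total p q with h | h
      · exact ⟨p, q, Or.inr hp, Or.inr hq, (Nat.mul_le_mul_left p h).trans hpq,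
          (Nat.le_mul_of_pos_left q hp.pos).trans hpq, hfac⟩
      · refine ⟨q, p, Or.inr hq, Or.inr hp, (Nat.mul_le_mul_right q h).trans hpq,
          (Nat.le_mul_of_pos_right p hq.pos).trans hpq, fun r hr hMr => ?_⟩
        rw [hfac r hr hMr, add_comm]
    · push Not at hq
      refine ⟨1, p, Or.inl rfl, Or.inr hp, by simpa using h1N,
        (Nat.le_mul_of_pos_right p (Nat.pos_of_ne_zero hb)).trans haN, fun r hr hMr => ?_⟩
      rw [factorization_prime_mul hp hb, Nat.factorization_eq_zero_of_not_dvd (hq r hr hMr),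
        if_neg (hone r hr), zero_add, add_zero]
  · push Not at hp
    refine ⟨1, 1, Or.inl rfl, Or.inl rfl, by simpa using h1N, h1N, fun r hr hMr => ?_⟩
    rw [Nat.factorization_eq_zero_of_not_dvd (hp r hr hMr), if_neg (hone r hr)]

lemma DistinctSubsetProds.eq_zero_of_sum_factorization {A : Finset ℕ}
    (hA : DistinctSubsetProds ↑A) (hA0 : ∀ a ∈ A, a ≠ 0) {η : ℕ → ℤ}
    (hη : ∀ a ∈ A, η a = 0 ∨ η a = 1 ∨ η a = -1)
    (h : ∀ p, p.Prime → ∑ a ∈ A, η a * (a.factorization p : ℤ) = 0) :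
    ∀ a ∈ A, η a = 0 := by
  set B := A.filter fun a => η a = 1 with hB
  set C := A.filter fun a => η a = -1 with hC
  have hB0 : ∀ b ∈ B, b ≠ 0 := fun b hb => hA0 b (Finset.mem_filter.1 hb).1
  have hC0 : ∀ c ∈ C, c ≠ 0 := fun c hc => hA0 c (Finset.mem_filter.1 hc).1
  have hprod : ∏ b ∈ B, b = ∏ c ∈ C, c := by
    refine Nat.eq_of_factorization_eq (Finset.prod_ne_zero_iff.2 hB0)
      (Finset.prod_ne_zero_iff.2 hC0) fun p => ?_
    by_cases hp : p.Prime
    · rw [Nat.factorization_prod hB0, Nat.factorization_prod hC0, Finsupp.finsetSum_apply,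
        Finsupp.finsetSum_apply]
      have h1 : ∑ a ∈ A, η a * (a.factorization p : ℤ) =
          ∑ b ∈ B, (b.factorization p : ℤ) - ∑ c ∈ C, (c.factorization p : ℤ) := by
        rw [hB, hC, Finset.sum_filter, Finset.sum_filter, ← Finset.sum_sub_distrib]
        refine Finset.sum_congr rfl fun a ha => ?_
        rcases hη a ha with h | h | h <;> simp [h]
      rw [h p hp] at h1
      have h2 := (sub_eq_zero.1 h1.symm)
      exact_mod_cast h2
    · rw [Nat.factorization_eq_zero_of_not_prime _ hp, Nat.factorization_eq_zero_of_not_prime _ hp]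
  have hBC := hA B C (by exact_mod_cast Finset.filter_subset _ _)
    (by exact_mod_cast Finset.filter_subset _ _) hprod
  intro a ha
  rcases hη a ha with h | h | h
  · exact h
  · have h1 : a ∈ C := hBC ▸ Finset.mem_filter.2 ⟨ha, h⟩
    have := (Finset.mem_filter.1 h1).2
    omega
  · have h1 : a ∈ B := hBC ▸ Finset.mem_filter.2 ⟨ha, h⟩
    have := (Finset.mem_filter.1 h1).2
    omega

/-- There are few disjoint signed relations between the large prime factors of the elements of a
set with distinct subset products. -/
lemma DistinctSubsetProds.two_pow_card_le {A : Finset ℕ} {N M L : ℕ}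
    (hA : DistinctSubsetProds ↑A) (hAN : A ⊆ Finset.Icc 1 N) {x y : ℕ → ℕ}
    (hxy : ∀ a ∈ A, ∀ p, p.Prime → M < p →
      a.factorization p = (if x a = p then 1 else 0) + (if y a = p then 1 else 0))
    {𝒮 : Finset (Finset ℕ)} (h𝒮 : ∀ S ∈ 𝒮, S ⊆ A ∧ IsSignedRelation x y L S)
    (hdisj : (𝒮 : Set (Finset ℕ)).PairwiseDisjoint id) :
    2 ^ 𝒮.card ≤ (2 * N ^ 2 + 1) ^ (M + 1) := by
  have hA0 : ∀ a ∈ A, a ≠ 0 := fun a ha => by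
    have := Finset.mem_Icc.1 (hAN ha)
    omega
  obtain ⟨e, he, hesum⟩ : ∃ e : ℕ → ℤ, (∀ a, e a = 1 ∨ e a = -1) ∧
      ∀ S ∈ 𝒮, ∑ a ∈ S, e a • incidence x y a = 0 := by
    have h1 : ∀ S, ∃ ε : ℕ → ℤ, S ∈ 𝒮 → (∀ a, ε a = 1 ∨ ε a = -1) ∧
        ∑ a ∈ S, ε a • incidence x y a = 0 := fun S => by
      by_cases hS : S ∈ 𝒮
      · obtain ⟨ε, hε⟩ := (h𝒮 S hS).2.2.2
        exact ⟨ε, fun _ => hε⟩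
      · exact ⟨0, fun h => absurd h hS⟩
    choose ε hε using h1
    have h2 : ∀ a, ∃ S, (∃ S' ∈ 𝒮, a ∈ S') → S ∈ 𝒮 ∧ a ∈ S := fun a => by
      by_cases ha : ∃ S' ∈ 𝒮, a ∈ S'
      · exact ⟨ha.choose, fun _ => ha.choose_spec⟩
      · exact ⟨∅, fun h => absurd h ha⟩
    choose w hw using h2
    refine ⟨fun a => if w a ∈ 𝒮 then ε (w a) a else 1, fun a => ?_, fun S hS => ?_⟩
    · by_cases ha : w a ∈ 𝒮
      · simpa [ha] using (hε _ ha).1 a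
      · simp [ha]
    · rw [← (hε S hS).2]
      refine Finset.sum_congr rfl fun a ha => ?_
      obtain ⟨h3, h4⟩ := hw a ⟨S, hS, ha⟩
      have h5 : w a = S := hdisj.elim_finset h3 hS a h4 ha
      simp [h5, hS]
  have hUA : ∀ J ⊆ 𝒮, J.biUnion id ⊆ A := fun J hJ =>
    Finset.biUnion_subset.2 fun S hS => (h𝒮 S (hJ hS)).1
  have hcardA : A.card ≤ N := by simpa using Finset.card_le_card hAN
  by_contra hlt
  obtain ⟨J₁, hJ₁, J₂, hJ₂, hne, heq⟩ := Finset.exists_ne_map_eq_of_card_lt_of_maps_to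
    (s := 𝒮.powerset)
    (t := Fintype.piFinset fun _ : Fin (M + 1) => Finset.Icc (-(N ^ 2 : ℤ)) (N ^ 2))
    (f := fun J p => ∑ a ∈ J.biUnion id, e a * (a.factorization p : ℤ))
    (by
      rw [Finset.card_powerset, Fintype.card_piFinset]
      simp only [Int.card_Icc, Finset.prod_const, Finset.card_univ, Fintype.card_fin]
      have h1 : ((N : ℤ) ^ 2 + 1 - -(N : ℤ) ^ 2).toNat = 2 * N ^ 2 + 1 := by
        have : (N : ℤ) ^ 2 + 1 - -(N : ℤ) ^ 2 = ((2 * N ^ 2 + 1 : ℕ) : ℤ) := by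
          push_cast
          ring
        rw [this, Int.toNat_natCast]
      rw [h1]
      exact not_le.1 hlt)
    (fun J hJ => by
      have hJ := hUA J (Finset.mem_powerset.1 (Finset.mem_coe.1 hJ))
      refine Finset.mem_coe.2 (Fintype.mem_piFinset.2 fun p => Finset.mem_Icc.2 (abs_le.1 ?_))
      calc |∑ a ∈ J.biUnion id, e a * (a.factorization p : ℤ)|
          ≤ ∑ a ∈ J.biUnion id, |e a * (a.factorization p : ℤ)| := Finset.abs_sum_le_sum_abs _ _
        _ ≤ ∑ a ∈ J.biUnion id, (N : ℤ) := by
          refine Finset.sum_le_sum fun a ha => ?_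
          have h1 : |e a| = 1 := by rcases he a with h | h <;> simp [h]
          have h2 := Finset.mem_Icc.1 (hAN (hJ ha))
          have h3 := Nat.factorization_lt (n := a) p (by omega)
          rw [abs_mul, h1, one_mul, Nat.abs_cast]
          exact_mod_cast (h3.le.trans h2.2)
        _ = (J.biUnion id).card * (N : ℤ) := by simp
        _ ≤ N * N := by
          have := (Finset.card_le_card hJ).trans hcardA
          gcongr
        _ = (N : ℤ) ^ 2 := by ring)
  rw [Finset.mem_powerset] at hJ₁ hJ₂
  have hlarge : ∀ J ⊆ 𝒮, ∀ p, p.Prime → M < p →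
      ∑ a ∈ J.biUnion id, e a * (a.factorization p : ℤ) = 0 := by
    intro J hJ p hp hMp
    rw [Finset.sum_biUnion (hdisj.subset (by exact_mod_cast hJ))]
    refine Finset.sum_eq_zero fun S hS => ?_
    have h1 := congrFun (hesum S (hJ hS)) p
    rw [Finset.sum_apply] at h1
    rw [← Pi.zero_apply (M := fun _ : ℕ => ℤ) p, ← h1]
    refine Finset.sum_congr rfl fun a ha => ?_
    rw [hxy a ((h𝒮 S (hJ hS)).1 ha) p hp hMp]
    simp [incidence, Pi.single_apply, eq_comm]
  have hzero := hA.eq_zero_of_sum_factorization hA0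
    (η := fun a => e a * ((if a ∈ J₁.biUnion id then 1 else 0) -
      (if a ∈ J₂.biUnion id then 1 else 0)))
    (fun a _ => by rcases he a with h | h <;> simp only [h] <;> split_ifs <;> simp)
    (fun p hp => by
      have h1 : ∑ a ∈ A, (e a * ((if a ∈ J₁.biUnion id then 1 else 0) -
          (if a ∈ J₂.biUnion id then 1 else 0))) * (a.factorization p : ℤ) =
          ∑ a ∈ J₁.biUnion id, e a * (a.factorization p : ℤ) -
            ∑ a ∈ J₂.biUnion id, e a * (a.factorization p : ℤ) := by
        simp only [mul_sub, sub_mul, Finset.sum_sub_distrib, mul_ite, mul_one, mul_zero, ite_mul,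
          zero_mul, ← Finset.sum_filter, Finset.filter_mem_eq_inter,
          Finset.inter_eq_right.2 (hUA J₁ hJ₁), Finset.inter_eq_right.2 (hUA J₂ hJ₂)]
      rw [h1]
      rcases lt_or_ge M p with h | h
      · rw [hlarge J₁ hJ₁ p hp h, hlarge J₂ hJ₂ p hp h, sub_zero]
      · have := congrFun heq ⟨p, by omega⟩
        simpa [sub_eq_zero] using this)
  have hmem : ∀ a ∈ A, (a ∈ J₁.biUnion id ↔ a ∈ J₂.biUnion id) := by
    intro a ha
    have h1 := hzero a ha
    have h2 : e a ≠ 0 := by rcases he a with h | h <;> simp [h]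
    have h5 := (mul_eq_zero.1 h1).resolve_left h2
    by_cases h3 : a ∈ J₁.biUnion id <;> by_cases h4 : a ∈ J₂.biUnion id
    · exact iff_of_true h3 h4
    · rw [if_pos h3, if_neg h4] at h5
      norm_num at h5
    · rw [if_neg h3, if_pos h4] at h5
      norm_num at h5
    · exact iff_of_false h3 h4
  have hsub : ∀ J ⊆ 𝒮, ∀ J' ⊆ 𝒮,
      (∀ a ∈ A, a ∈ J.biUnion id → a ∈ J'.biUnion id) → J ⊆ J' := by
    intro J hJ J' hJ' h S hS
    obtain ⟨a, ha⟩ := (h𝒮 S (hJ hS)).2.1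
    obtain ⟨S', hS', ha'⟩ := Finset.mem_biUnion.1
      (h a ((h𝒮 S (hJ hS)).1 ha) (Finset.mem_biUnion.2 ⟨S, hS, ha⟩))
    rwa [hdisj.elim_finset (hJ hS) (hJ' hS') a ha ha']
  exact hne ((hsub _ hJ₁ _ hJ₂ fun a ha => (hmem a ha).1).antisymm
    (hsub _ hJ₂ _ hJ₁ fun a ha => (hmem a ha).2))

/-- The primes up to `n`. -/
def primesUpTo (n : ℕ) : Finset ℕ := (Finset.range (n + 1)).filter Nat.Prime

lemma mem_primesUpTo {n p : ℕ} : p ∈ primesUpTo n ↔ p.Prime ∧ p ≤ n := by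
  simp [primesUpTo, and_comm]

lemma DistinctSubsetProds.card_le {A : Finset ℕ} {N M d m : ℕ}
    (hA : DistinctSubsetProds ↑A) (hAN : A ⊆ Finset.Icc 1 N) (hM : N < (M + 1) ^ 3) (hd : 3 ≤ d)
    (hm : 6 * (Nat.sqrt N + 1) < 2 ^ m) :
    ∃ K, 2 ^ K ≤ (2 * N ^ 2 + 1) ^ (M + 1) ∧
      d * A.card ≤ d * ((primesUpTo N).card + (primesUpTo (Nat.sqrt N)).card + 2) +
        6 * (Nat.sqrt N + 1) + d * (K * (2 * (d * m) + 2)) := by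
  have hxy : ∀ a, ∃ x y : ℕ, a ∈ A → (x = 1 ∨ x.Prime) ∧ (y = 1 ∨ y.Prime) ∧ x * x ≤ N ∧ y ≤ N ∧
      ∀ p, p.Prime → M < p →
        a.factorization p = (if x = p then 1 else 0) + (if y = p then 1 else 0) := fun a => by
    by_cases ha : a ∈ A
    · have h1 := Finset.mem_Icc.1 (hAN ha)
      obtain ⟨x, y, h⟩ := exists_large_prime_factors hM (by omega : a ≠ 0) h1.2
      exact ⟨x, y, fun _ => h⟩
    · exact ⟨1, 1, fun h => absurd h ha⟩
  choose x y hxy using hxy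
  set L := 2 * (d * m) + 2 with hL
  classical
  obtain ⟨𝒮, h𝒮, hmax⟩ := Finset.exists_max_image
    (A.powerset.powerset.filter fun 𝒮 : Finset (Finset ℕ) => (∀ S ∈ 𝒮, IsSignedRelation x y L S) ∧
      (𝒮 : Set (Finset ℕ)).PairwiseDisjoint id) Finset.card ⟨∅, by simp⟩
  simp only [Finset.mem_filter, Finset.mem_powerset] at h𝒮 hmax
  obtain ⟨h𝒮A, h𝒮rel, hdisj⟩ := h𝒮
  refine ⟨𝒮.card, hA.two_pow_card_le hAN (fun a ha => (hxy a ha).2.2.2.2)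
    (fun S hS => ⟨Finset.mem_powerset.1 (h𝒮A hS), h𝒮rel S hS⟩) hdisj, ?_⟩
  set U := 𝒮.biUnion id with hU
  set T := insert 1 (primesUpTo (Nat.sqrt N)) with hT
  set H := primesUpTo N \ primesUpTo (Nat.sqrt N) with hH
  have hTcard : T.card = (primesUpTo (Nat.sqrt N)).card + 1 :=
    Finset.card_insert_of_notMem (by simp [mem_primesUpTo, Nat.not_prime_one])
  have hHcard : H.card + (primesUpTo (Nat.sqrt N)).card = (primesUpTo N).card :=
    Finset.card_sdiff_add_card_eq_card fun p hp => by
      rw [mem_primesUpTo] at hp ⊢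
      exact ⟨hp.1, hp.2.trans (Nat.sqrt_le_self N)⟩
  have hTle : T.card ≤ Nat.sqrt N + 1 := by
    have h1 : primesUpTo (Nat.sqrt N) ⊆ Finset.Icc 1 (Nat.sqrt N) := fun p hp => by
      rw [mem_primesUpTo] at hp
      exact Finset.mem_Icc.2 ⟨hp.1.one_le, hp.2⟩
    have h2 := Finset.card_le_card h1
    rw [Nat.card_Icc] at h2
    omega
  have hcard := card_le_of_forall_not_isSignedRelation (x := x) (y := y) (T := T) (H := H)
    (A := A \ U) (d := d) (m := m) hd ⟨1, Finset.mem_insert_self _ _⟩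
    (by
      rw [Finset.disjoint_left]
      intro p hp hpH
      rw [hH, Finset.mem_sdiff] at hpH
      rcases Finset.mem_insert.1 hp with rfl | h
      · exact Nat.not_prime_one (mem_primesUpTo.1 hpH.1).1
      · exact hpH.2 h)
    (fun a ha => by
      obtain ⟨h1, -, h2, -⟩ := hxy a (Finset.mem_sdiff.1 ha).1
      rcases h1 with h1 | h1
      · simp [hT, h1]
      · exact Finset.mem_insert_of_mem (mem_primesUpTo.2 ⟨h1, Nat.le_sqrt.2 h2⟩))
    (fun a ha => by
      obtain ⟨-, h1, -, h2, -⟩ := hxy a (Finset.mem_sdiff.1 ha).1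
      rcases h1 with h1 | h1
      · simp [hT, h1]
      · by_cases h3 : y a ∈ primesUpTo (Nat.sqrt N)
        · exact Finset.mem_union_left _ (Finset.mem_insert_of_mem h3)
        · exact Finset.mem_union_right _
            (Finset.mem_sdiff.2 ⟨mem_primesUpTo.2 ⟨h1, h2⟩, h3⟩))
    (by omega)
    (fun S hS hSrel => by
      have hSU : Disjoint S U := Finset.disjoint_of_subset_left hS Finset.sdiff_disjoint
      have hSA : S ⊆ A := hS.trans Finset.sdiff_subset
      have hSdisj : ∀ R ∈ 𝒮, Disjoint S R := fun R hR =>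
        Finset.disjoint_of_subset_right (Finset.subset_biUnion_of_mem id hR) hSU
      have hS𝒮 : S ∉ 𝒮 := fun h => by
        obtain ⟨a, ha⟩ := hSrel.1
        exact Finset.disjoint_left.1 (hSdisj S h) ha ha
      have h1 := hmax (insert S 𝒮) ⟨Finset.insert_subset (Finset.mem_powerset.2 hSA) h𝒮A,
        fun R hR => by
          rcases Finset.mem_insert.1 hR with rfl | hR
          · exact hSrel
          · exact h𝒮rel R hR,
        by
          rw [Finset.coe_insert]
          exact hdisj.insert fun R hR _ => hSdisj R hR⟩
      rw [Finset.card_insert_of_notMem hS𝒮] at h1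
      omega)
  have hUcard : U.card ≤ 𝒮.card * L := Finset.card_biUnion_le_card_mul _ _ _
    fun S hS => (h𝒮rel S hS).2.1
  have h1 : A.card ≤ (A \ U).card + U.card := by
    have := Finset.le_card_sdiff U A
    omega
  calc d * A.card ≤ d * ((A \ U).card + 𝒮.card * L) :=
        Nat.mul_le_mul_left d (h1.trans (Nat.add_le_add_left hUcard _))
    _ = d * (A \ U).card + d * (𝒮.card * L) := mul_add _ _ _
    _ ≤ d * (H.card + 2 * T.card) + 6 * T.card + d * (𝒮.card * L) :=
        Nat.add_le_add_right hcard _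
    _ ≤ _ := by
        have h2 : H.card + 2 * T.card =
            (primesUpTo N).card + (primesUpTo (Nat.sqrt N)).card + 2 := by omega
        rw [h2]
        omega

/-- The primes up to `N` and the squares of the primes up to `√N` have distinct subset
products. -/
lemma distinctSubsetProds_primes_union_squares (N : ℕ) :
    DistinctSubsetProds ↑(primesUpTo N ∪ (primesUpTo (Nat.sqrt N)).image (· ^ 2)) := by
  intro B C hB hC hBC
  have hform : ∀ D : Finset ℕ,
      (D : Set ℕ) ⊆ ↑(primesUpTo N ∪ (primesUpTo (Nat.sqrt N)).image (· ^ 2)) →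
      ∀ b ∈ D, b.Prime ∨ ∃ q : ℕ, q.Prime ∧ b = q ^ 2 := by
    intro D hD b hb
    have h1 := Finset.mem_coe.1 (hD hb)
    rw [Finset.mem_union, Finset.mem_image] at h1
    rcases h1 with h1 | ⟨q, hq, h1⟩
    · exact Or.inl (mem_primesUpTo.1 h1).1
    · exact Or.inr ⟨q, (mem_primesUpTo.1 hq).1, h1.symm⟩
  have hfac : ∀ D : Finset ℕ,
      (D : Set ℕ) ⊆ ↑(primesUpTo N ∪ (primesUpTo (Nat.sqrt N)).image (· ^ 2)) →
      ∀ p, p.Prime → (∏ b ∈ D, b).factorization p =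
        (if p ∈ D then 1 else 0) + (if p ^ 2 ∈ D then 2 else 0) := by
    intro D hD p hp
    have hD0 : ∀ b ∈ D, b ≠ 0 := by
      intro b hb
      rcases hform D hD b hb with h | ⟨q, hq, rfl⟩
      · exact h.ne_zero
      · exact pow_ne_zero 2 hq.ne_zero
    rw [Nat.factorization_prod hD0, Finsupp.finsetSum_apply]
    have h1 : ∀ b ∈ D, b.factorization p =
        (if p = b then 1 else 0) + (if p ^ 2 = b then 2 else 0) := by
      intro b hb
      rcases hform D hD b hb with h | ⟨q, hq, rfl⟩
      · have h2 : p ^ 2 ≠ b := fun h2 => Nat.Prime.not_prime_pow le_rfl (h2 ▸ h)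
        rw [h.factorization, Finsupp.single_apply, if_neg h2, add_zero]
        simp [eq_comm]
      · have h2 : p ≠ q ^ 2 := fun h2 => Nat.Prime.not_prime_pow le_rfl (h2 ▸ hp)
        rw [hq.factorization_pow, Finsupp.single_apply, if_neg h2, zero_add]
        refine if_congr ?_ rfl rfl
        rw [eq_comm, Nat.pow_left_inj two_ne_zero]
    rw [Finset.sum_congr rfl h1, Finset.sum_add_distrib, Finset.sum_ite_eq, Finset.sum_ite_eq]
  have hiff : ∀ p, p.Prime → ((p ∈ B ↔ p ∈ C) ∧ (p ^ 2 ∈ B ↔ p ^ 2 ∈ C)) := by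
    intro p hp
    have h1 := hfac B hB p hp
    rw [hBC, hfac C hC p hp] at h1
    split_ifs at h1 <;> simp_all
  ext b
  constructor
  · intro hb
    rcases hform B hB b hb with h | ⟨q, hq, rfl⟩
    · exact (hiff b h).1.1 hb
    · exact (hiff q hq).2.1 hb
  · intro hb
    rcases hform C hC b hb with h | ⟨q, hq, rfl⟩
    · exact (hiff b h).1.2 hb
    · exact (hiff q hq).2.2 hb

lemma bddAbove_card_distinctSubsetProds (N : ℕ) :
    BddAbove {k | ∃ A : Finset ℕ, ↑A ⊆ Set.Icc 1 N ∧ DistinctSubsetProds ↑A ∧ A.card = k} := by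
  refine ⟨N, ?_⟩
  rintro k ⟨A, hA, -, rfl⟩
  have h1 : A ⊆ Finset.Icc 1 N := by
    rw [← Finset.coe_subset, Finset.coe_Icc]
    exact hA
  simpa using Finset.card_le_card h1

lemma le_maxDSP (N : ℕ) : (primesUpTo N).card + (primesUpTo (Nat.sqrt N)).card ≤ maxDSP N := by
  refine le_csSup (bddAbove_card_distinctSubsetProds N)
    ⟨_, ?_, distinctSubsetProds_primes_union_squares N, ?_⟩
  · intro a ha
    rw [Finset.mem_coe, Finset.mem_union, Finset.mem_image] at ha
    rcases ha with ha | ⟨q, hq, rfl⟩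
    · rw [mem_primesUpTo] at ha
      exact ⟨ha.1.one_le, ha.2⟩
    · rw [mem_primesUpTo] at hq
      exact ⟨Nat.one_le_pow _ _ hq.1.pos, Nat.le_sqrt'.1 hq.2⟩
  · rw [Finset.card_union_of_disjoint, Finset.card_image_of_injective _
      (Nat.pow_left_injective two_ne_zero)]
    rw [Finset.disjoint_left]
    intro a ha h
    obtain ⟨q, -, rfl⟩ := Finset.mem_image.1 h
    exact Nat.Prime.not_prime_pow le_rfl (mem_primesUpTo.1 ha).1

lemma exists_card_eq_maxDSP (N : ℕ) :
    ∃ A : Finset ℕ, A ⊆ Finset.Icc 1 N ∧ DistinctSubsetProds ↑A ∧ A.card = maxDSP N := by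
  obtain ⟨A, hA, h⟩ := Nat.sSup_mem (s := {k | ∃ A : Finset ℕ, ↑A ⊆ Set.Icc 1 N ∧
    DistinctSubsetProds ↑A ∧ A.card = k}) ⟨0, ∅, by simp, by
      intro B C hB hC _
      simp_all, rfl⟩ (bddAbove_card_distinctSubsetProds N)
  refine ⟨A, ?_, h⟩
  rw [← Finset.coe_subset, Finset.coe_Icc]
  exact hA

end Multiplicative

lemma primePi_eq_card {x : ℝ} {n : ℕ} (h : ∀ p : ℕ, (p : ℝ) ≤ x ↔ p ≤ n) :
    primePi x = (primesUpTo n).card := by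
  rw [primePi, ← Set.ncard_coe_finset]
  congr 1
  ext p
  simp [mem_primesUpTo, h]

lemma primePi_natCast (N : ℕ) : primePi N = (primesUpTo N).card :=
  primePi_eq_card fun _ => Nat.cast_le

lemma primePi_rpow_half (N : ℕ) :
    primePi ((N : ℝ) ^ ((1 : ℝ) / 2)) = (primesUpTo (Nat.sqrt N)).card :=
  primePi_eq_card fun p => by
    rw [← Real.sqrt_eq_rpow, Real.le_sqrt (Nat.cast_nonneg p) (Nat.cast_nonneg N), Nat.le_sqrt']
    exact_mod_cast Iff.rfl

lemma maxDSP_le {N : ℕ} (hN : 1 ≤ N) :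
    (maxDSP N : ℝ) ≤ primePi N + primePi ((N : ℝ) ^ ((1 : ℝ) / 2)) +
      110 * ((Nat.log 2 N : ℝ) + 5) ^ 2 * (N : ℝ) ^ ((5 : ℝ) / 12) := by
  rw [primePi_natCast, primePi_rpow_half]
  have hN' : (1 : ℝ) ≤ N := by exact_mod_cast hN
  have hN0 : (0 : ℝ) ≤ N := by linarith
  set c : ℝ := (N : ℝ) ^ ((1 : ℝ) / 12) with hc
  have hc1 : 1 ≤ c := Real.one_le_rpow hN' (by norm_num)
  have hcpow : ∀ k : ℕ, (N : ℝ) ^ ((k : ℝ) / 12) = c ^ k := fun k => by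
    rw [hc, ← Real.rpow_natCast, ← Real.rpow_mul hN0]
    ring_nf
  have hc5 : (N : ℝ) ^ ((5 : ℝ) / 12) = c ^ 5 := by exact_mod_cast hcpow 5
  have hc12 : (N : ℝ) = c ^ 12 := by
    rw [← hcpow 12]
    norm_num
  have hsqrt : (Nat.sqrt N : ℝ) ≤ c ^ 6 := by
    have h1 : (Nat.sqrt N : ℝ) ^ 2 ≤ (c ^ 6) ^ 2 := by
      rw [← pow_mul, ← hc12]
      exact_mod_cast Nat.sqrt_le' N
    exact (pow_le_pow_iff_left₀ (by positivity) (by positivity) two_ne_zero).1 h1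
  set M := ⌊c ^ 4⌋₊ with hMdef
  set d := ⌈c⌉₊ + 2 with hddef
  set m := Nat.log 2 N + 5 with hmdef
  have hM : N < (M + 1) ^ 3 := by
    have h1 : c ^ 4 < M + 1 := Nat.lt_floor_add_one _
    have h2 : (N : ℝ) < (M + 1) ^ 3 := by
      rw [hc12]
      calc c ^ 12 = (c ^ 4) ^ 3 := by ring
        _ < _ := by gcongr
    exact_mod_cast h2
  have hMle : (M : ℝ) ≤ c ^ 4 := Nat.floor_le (by positivity)
  have hdc : c ≤ d := by
    have := Nat.le_ceil c
    push_cast [hddef]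
    linarith
  have hd4 : (d : ℝ) ≤ 4 * c := by
    have := Nat.ceil_lt_add_one (by linarith : 0 ≤ c)
    push_cast [hddef]
    linarith
  have hd3 : 3 ≤ d := by
    have := Nat.ceil_pos.2 (by linarith : 0 < c)
    omega
  have hlog : N < 2 ^ (Nat.log 2 N + 1) := Nat.lt_pow_succ_log_self (by norm_num) N
  have hm2 : 2 ^ m = 2 ^ (Nat.log 2 N + 1) * 16 := by
    rw [hmdef, pow_add, pow_add]
    ring
  have hsqrtN := Nat.sqrt_le_self N
  obtain ⟨A, hAN, hA, hcard⟩ := exists_card_eq_maxDSP N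
  obtain ⟨K, hK, hle⟩ := hA.card_le hAN hM hd3 (m := m) (by omega)
  have hKle : K ≤ 3 * m * (M + 1) := by
    rw [← Nat.pow_le_pow_iff_right (a := 2) (by norm_num), pow_mul]
    refine hK.trans (Nat.pow_le_pow_left ?_ _)
    have h1 : N ≤ 2 ^ m := by omega
    have h2 : 3 ≤ 2 ^ m := by omega
    calc 2 * N ^ 2 + 1 ≤ 3 * N ^ 2 := by nlinarith
      _ ≤ 2 ^ m * (2 ^ m) ^ 2 := Nat.mul_le_mul h2 (Nat.pow_le_pow_left h1 2)
      _ = 2 ^ (3 * m) := by ring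
  rw [hcard] at hle
  have hle' : (d : ℝ) * maxDSP N ≤ d * ((primesUpTo N).card + (primesUpTo (Nat.sqrt N)).card + 2) +
      6 * (Nat.sqrt N + 1) + d * (K * (2 * (d * m) + 2)) := by exact_mod_cast hle
  have hKle' : (K : ℝ) ≤ 3 * m * (M + 1) := by exact_mod_cast hKle
  have hm1 : (1 : ℝ) ≤ m := by
    push_cast [hmdef]
    have : (0 : ℝ) ≤ Nat.log 2 N := Nat.cast_nonneg _
    linarith
  have hmcast : (Nat.log 2 N : ℝ) + 5 = m := by push_cast [hmdef]; rfl
  rw [hc5, hmcast]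
  have hd0 : (0 : ℝ) < d := by linarith
  have hc5' : 1 ≤ c ^ 5 := one_le_pow₀ hc1
  have hmc : 1 * 1 ≤ (m : ℝ) ^ 2 * c ^ 5 := by
    gcongr
    exact one_le_pow₀ hm1
  have e1 : 6 * ((Nat.sqrt N : ℝ) + 1) ≤ d * (12 * ((m : ℝ) ^ 2 * c ^ 5)) := by
    calc 6 * ((Nat.sqrt N : ℝ) + 1) ≤ 6 * (c ^ 6 + c ^ 6) := by
          have : 1 ≤ c ^ 6 := one_le_pow₀ hc1
          gcongr
      _ = c * (12 * (1 * c ^ 5)) := by ring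
      _ ≤ d * (12 * ((m : ℝ) ^ 2 * c ^ 5)) := by
          gcongr
          exact one_le_pow₀ hm1
  have e2 : (K : ℝ) * (2 * (d * m) + 2) ≤ 96 * ((m : ℝ) ^ 2 * c ^ 5) := by
    have hMM : (M : ℝ) + 1 ≤ 2 * c ^ 4 := by
      have : 1 ≤ c ^ 4 := one_le_pow₀ hc1
      linarith
    have h1 : 2 * ((d : ℝ) * m) + 2 ≤ 16 * (c * m) := by
      have h3 : 1 * 1 ≤ c * m := by gcongr
      have h4 : (d : ℝ) * m ≤ 4 * c * m := by gcongr
      linarith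
    calc (K : ℝ) * (2 * (d * m) + 2) ≤ (3 * m * (2 * c ^ 4)) * (16 * (c * m)) := by
          gcongr
          exact hKle'.trans (by gcongr)
      _ = 96 * ((m : ℝ) ^ 2 * c ^ 5) := by ring
  have e3 : (d : ℝ) * (K * (2 * (d * m) + 2)) ≤ d * (96 * ((m : ℝ) ^ 2 * c ^ 5)) := by gcongr
  have e4 : (d : ℝ) * 2 ≤ d * (2 * ((m : ℝ) ^ 2 * c ^ 5)) := by
    gcongr
    linarith
  refine le_of_mul_le_mul_left ?_ hd0
  linarith

lemma natLog_two_add_five_le {ε : ℝ} (hε : 0 < ε) {N : ℕ} (hN : 1 ≤ N) :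
    (Nat.log 2 N : ℝ) + 5 ≤ (2 / (ε * Real.log 2) + 5) * (N : ℝ) ^ (ε / 2) := by
  have hN' : (1 : ℝ) ≤ N := by exact_mod_cast hN
  have hlog2 : 0 < Real.log 2 := Real.log_pos one_lt_two
  have h1 : (Nat.log 2 N : ℝ) ≤ Real.logb 2 N := by exact_mod_cast Real.natLog_le_logb N 2
  have h2 := Real.log_le_rpow_div (x := N) (by linarith) (half_pos hε)
  have h3 : 1 ≤ (N : ℝ) ^ (ε / 2) := Real.one_le_rpow hN' (half_pos hε).le
  have h4 : Real.logb 2 N ≤ 2 / (ε * Real.log 2) * (N : ℝ) ^ (ε / 2) := by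
    rw [Real.logb]
    calc Real.log N / Real.log 2 ≤ ((N : ℝ) ^ (ε / 2) / (ε / 2)) / Real.log 2 := by gcongr
      _ = _ := by field_simp
  linarith

/-- `f(N) = π(N) + π(N^{1/2}) + O(N^{5/12+o(1)})`. -/
theorem stmt0 : ∀ ε : ℝ, 0 < ε → ∃ C : ℝ, 0 < C ∧ ∀ N : ℕ,
    |(maxDSP N : ℝ) - primePi N - primePi ((N : ℝ) ^ ((1 : ℝ) / 2))| ≤
      C * (N : ℝ) ^ ((5 : ℝ) / 12 + ε) := by
  intro ε hε
  have hlog2 : 0 < Real.log 2 := Real.log_pos one_lt_two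
  refine ⟨110 * (2 / (ε * Real.log 2) + 5) ^ 2, by positivity, fun N => ?_⟩
  have hlow : (primePi N : ℝ) + primePi ((N : ℝ) ^ ((1 : ℝ) / 2)) ≤ maxDSP N := by
    rw [primePi_natCast, primePi_rpow_half]
    exact_mod_cast le_maxDSP N
  rw [abs_of_nonneg (by linarith)]
  rcases Nat.eq_zero_or_pos N with rfl | hN
  · obtain ⟨A, hA, -, hcard⟩ := exists_card_eq_maxDSP 0
    have hA0 : A = ∅ := by simpa using hA
    have h1 : maxDSP 0 = 0 := by rw [← hcard, hA0, Finset.card_empty]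
    have h2 : (0 : ℝ) ≤ 110 * (2 / (ε * Real.log 2) + 5) ^ 2 *
        ((0 : ℕ) : ℝ) ^ ((5 : ℝ) / 12 + ε) := by positivity
    rw [h1]
    refine le_trans ?_ h2
    have h3 : (0 : ℝ) ≤ primePi ((0 : ℕ) : ℝ) := Nat.cast_nonneg _
    have h4 : (0 : ℝ) ≤ primePi (((0 : ℕ) : ℝ) ^ ((1 : ℝ) / 2)) := Nat.cast_nonneg _
    push_cast at *
    linarith
  · have hN0 : (0 : ℝ) < N := by exact_mod_cast hN
    have h1 := maxDSP_le hN
    have h2 : 110 * ((Nat.log 2 N : ℝ) + 5) ^ 2 * (N : ℝ) ^ ((5 : ℝ) / 12) ≤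
        110 * ((2 / (ε * Real.log 2) + 5) * (N : ℝ) ^ (ε / 2)) ^ 2 * (N : ℝ) ^ ((5 : ℝ) / 12) := by
      gcongr
      exact natLog_two_add_five_le hε hN
    have h3 : (N : ℝ) ^ ((5 : ℝ) / 12 + ε) =
        ((N : ℝ) ^ (ε / 2)) ^ 2 * (N : ℝ) ^ ((5 : ℝ) / 12) := by
      rw [← Real.rpow_natCast, ← Real.rpow_mul hN0.le, ← Real.rpow_add hN0]
      congr 1
      push_cast
      ring
    rw [h3]
    linarith [mul_pow (2 / (ε * Real.log 2) + 5) ((N : ℝ) ^ (ε / 2)) 2]
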